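/- There exists a constant $\alpha_0 > 0$ such that for every $\alpha \ge \alpha_0$ and every $r > 2M$ one has $2\,f^b(r)\,(r - 3M)\,r^2 + H(r) + F(r)\,r^6 \ge 0$. -/

import Mathlib

/-- The Regge–Wheeler (tortoise) coordinate. -/
noncomputable def rstar (M r : ℝ) : ℝ :=
  r + 2 * M * Real.log (r - 2 * M) - 3 * M - 2 * M * Real.log M

/-- x = r* - α - α^{1/2}. -/
noncomputable def xx (M α r : ℝ) : ℝ := rstar M r - α - Real.sqrt α

/-- f^b = α⁻¹ (arctan(x/α) - arctan(-1 - α^{-1/2})). -/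
noncomputable def fb (M α r : ℝ) : ℝ :=
  α⁻¹ * (Real.arctan (xx M α r / α) - Real.arctan (-1 - (Real.sqrt α)⁻¹))

/-- The constant C_* = 9 α² M³ / (2((α + α^{1/2})² + α²)). -/
noncomputable def Cstar (M α : ℝ) : ℝ :=
  9 * α ^ 2 * M ^ 3 / (2 * ((α + Real.sqrt α) ^ 2 + α ^ 2))

/-- H(r) = M f^b(r) (3r² - 8Mr) - 2 C_* (r - 3M)/α². -/
noncomputable def HH (M α r : ℝ) : ℝ :=
  M * fb M α r * (3 * r ^ 2 - 8 * M * r) - 2 * Cstar M α * (r - 3 * M) / α ^ 2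

/-- μ = 2M/r. -/
noncomputable def mu (M r : ℝ) : ℝ := 2 * M / r

/-- F = (1/(2(1-μ))) (x² - α²)/((x² + α²)³). -/
noncomputable def FF (M α r : ℝ) : ℝ :=
  1 / (2 * (1 - mu M r)) * (((xx M α r) ^ 2 - α ^ 2) / ((xx M α r) ^ 2 + α ^ 2) ^ 3)

/-- The tangent line of `arctan` at a point `a ≤ 0` stays below `arctan` on `(-∞, -a]`. -/
theorem sub_div_le_arctan_sub_arctan {a y : ℝ} (ha : a ≤ 0) (hy : y ≤ -a) :
    (y - a) / (1 + a ^ 2) ≤ Real.arctan y - Real.arctan a := by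
  have hd : ∀ z : ℝ, HasDerivAt (fun z => Real.arctan z - z / (1 + a ^ 2))
      (1 / (1 + z ^ 2) - 1 / (1 + a ^ 2)) z := fun z =>
    (Real.hasDerivAt_arctan z).sub ((hasDerivAt_id z).div_const _)
  have hc : Continuous fun z => Real.arctan z - z / (1 + a ^ 2) :=
    continuous_iff_continuousAt.2 fun z => (hd z).continuousAt
  have key : Real.arctan a - a / (1 + a ^ 2) ≤ Real.arctan y - y / (1 + a ^ 2) := by
    rcases le_total a y with h | h
    · refine monotoneOn_of_deriv_nonneg (convex_Icc a (-a)) hc.continuousOn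
        (fun z _ => (hd z).differentiableAt.differentiableWithinAt) (fun z hz => ?_)
        ⟨le_rfl, by linarith⟩ ⟨h, hy⟩ h
      rw [interior_Icc] at hz
      rw [(hd z).deriv, sub_nonneg]
      exact one_div_le_one_div_of_le (by positivity) (by nlinarith [hz.1, hz.2])
    · refine antitoneOn_of_deriv_nonpos (convex_Iic a) hc.continuousOn
        (fun z _ => (hd z).differentiableAt.differentiableWithinAt) (fun z hz => ?_)
        (Set.mem_Iic.2 h) (Set.mem_Iic.2 le_rfl) h
      rw [interior_Iic] at hz
      rw [(hd z).deriv, sub_nonpos]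
      exact one_div_le_one_div_of_le (by positivity) (by nlinarith [Set.mem_Iio.1 hz])
  rw [sub_div]
  linarith

theorem rstar_eq {M r : ℝ} (hM : 0 < M) (hr : 2 * M < r) :
    rstar M r = (r - 3 * M) + 2 * M * Real.log ((r - 2 * M) / M) := by
  rw [rstar, Real.log_div (by linarith) hM.ne']
  ring

theorem rstar_le {M r : ℝ} (hM : 0 < M) (hr : 2 * M < r) : rstar M r ≤ 3 * (r - 3 * M) := by
  have h := Real.log_le_sub_one_of_pos (div_pos (sub_pos.2 hr) hM)
  have e : 2 * M * ((r - 2 * M) / M - 1) = 2 * (r - 3 * M) := by field_simp; ring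
  have := mul_le_mul_of_nonneg_left h (by positivity : 0 ≤ 2 * M)
  rw [rstar_eq hM hr]
  linarith

theorem le_rstar {M r : ℝ} (hM : 0 < M) (hr : 2 * M < r) :
    (r - 3 * M) * r / (r - 2 * M) ≤ rstar M r := by
  have hp : 0 < r - 2 * M := sub_pos.2 hr
  have h := Real.one_sub_inv_le_log_of_pos (div_pos hp hM)
  have e : (r - 3 * M) * r / (r - 2 * M) =
      (r - 3 * M) + 2 * M * (1 - ((r - 2 * M) / M)⁻¹) := by
    rw [inv_div, div_eq_iff hp.ne', add_mul, mul_assoc (2 * M), sub_mul 1,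
      div_mul_cancel₀ _ hp.ne']
    ring
  have := mul_le_mul_of_nonneg_left h (by positivity : 0 ≤ 2 * M)
  rw [rstar_eq hM hr, e]
  linarith

theorem le_rstar_of_three_mul_le {M r : ℝ} (hM : 0 < M) (hr : 3 * M ≤ r) :
    r - 3 * M ≤ rstar M r := by
  have h2 : 2 * M < r := by linarith
  refine le_trans ?_ (le_rstar hM h2)
  rw [le_div_iff₀ (by linarith)]
  nlinarith

/-- `2 (r - 3M) r² + M (3r² - 8Mr)`, the coefficient of `f^b`. -/
def fbCoeff (M r : ℝ) : ℝ := r * (2 * r ^ 2 - 3 * M * r - 8 * M ^ 2)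

theorem le_rstar_mul_fbCoeff {M r : ℝ} (hM : 0 < M) (hr : 2 * M < r) (hQ : 0 ≤ fbCoeff M r) :
    9 * M ^ 3 * (r - 3 * M) ≤ rstar M r * fbCoeff M r := by
  have hp : 0 < r - 2 * M := sub_pos.2 hr
  refine le_trans ?_ (mul_le_mul_of_nonneg_right (le_rstar hM hr) hQ)
  rw [div_mul_eq_mul_div, le_div_iff₀ hp, ← sub_nonneg]
  obtain ⟨p, rfl⟩ : ∃ p, r = p + 2 * M := ⟨r - 2 * M, by ring⟩
  have hp : 0 < p := by linarith
  have e : (p + 2 * M - 3 * M) * (p + 2 * M) * fbCoeff M (p + 2 * M)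
      - 9 * M ^ 3 * (p + 2 * M - 3 * M) * (p + 2 * M - 2 * M)
      = (p - M) ^ 2 * (2 * p ^ 3 + 15 * p ^ 2 * M + 37 * p * M ^ 2 + 24 * M ^ 3) := by
    simp only [fbCoeff]; ring
  rw [e]
  positivity

theorem one_sub_mu_inv {M r : ℝ} (hM : 0 < M) (hr : 2 * M < r) :
    1 / (2 * (1 - mu M r)) = r / (2 * (r - 2 * M)) := by
  have : 0 < r - 2 * M := sub_pos.2 hr
  have : 0 < r := by linarith
  rw [mu]
  field_simp

/-- The quantity to be shown nonnegative, with `f^b` factored out. -/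
theorem energy_eq {M α r : ℝ} (hα : 0 < α) :
    2 * fb M α r * (r - 3 * M) * r ^ 2 + HH M α r + FF M α r * r ^ 6 =
      fb M α r * fbCoeff M r - 9 * M ^ 3 * (r - 3 * M) / ((α + √α) ^ 2 + α ^ 2)
        + FF M α r * r ^ 6 := by
  rw [HH, Cstar, fbCoeff]
  field_simp
  ring

theorem neg_one_sub_inv_sqrt {α : ℝ} (hα : 0 < α) : -1 - (√α)⁻¹ = -(α + √α) / α := by
  have hs : 0 < √α := Real.sqrt_pos.2 hα
  have h := Real.sq_sqrt hα.le
  field_simp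
  nlinarith

theorem rstar_div_le_fb {M α r : ℝ} (hα : 0 < α) (hx : xx M α r ≤ α + √α) :
    rstar M r / ((α + √α) ^ 2 + α ^ 2) ≤ fb M α r := by
  have hs : 0 < √α := Real.sqrt_pos.2 hα
  have h := sub_div_le_arctan_sub_arctan (a := -(α + √α) / α) (y := xx M α r / α)
    (div_nonpos_of_nonpos_of_nonneg (by linarith) hα.le)
    (by rw [neg_div, neg_neg]; gcongr)
  rw [fb, neg_one_sub_inv_sqrt hα]
  refine le_trans (le_of_eq ?_) (mul_le_mul_of_nonneg_left h (by positivity))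
  rw [xx]
  field_simp
  ring

theorem fb_nonpos {M α r : ℝ} (hα : 0 < α) (h : rstar M r ≤ 0) : fb M α r ≤ 0 := by
  rw [fb, neg_one_sub_inv_sqrt hα]
  refine mul_nonpos_of_nonneg_of_nonpos (by positivity) (sub_nonpos.2 (Real.arctan_mono ?_))
  gcongr
  rw [xx]
  linarith

/-- Past `x = α` the function `f^b` exceeds its tangent-line bound at `x = α`. -/
theorem le_fb_of_le_xx {M α r : ℝ} (hα : 0 < α) (hx : α ≤ xx M α r) :
    (2 * α + √α) / ((α + √α) ^ 2 + α ^ 2) ≤ fb M α r := by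
  have hs : 0 < √α := Real.sqrt_pos.2 hα
  have h := sub_div_le_arctan_sub_arctan (a := -(α + √α) / α) (y := 1)
    (div_nonpos_of_nonpos_of_nonneg (by linarith) hα.le)
    (by rw [neg_div, neg_neg, one_le_div hα]; linarith)
  have h1 : Real.arctan 1 ≤ Real.arctan (xx M α r / α) :=
    Real.arctan_mono ((one_le_div hα).2 hx)
  rw [fb, neg_one_sub_inv_sqrt hα]
  refine le_trans (le_of_eq ?_)
    (mul_le_mul_of_nonneg_left (h.trans (sub_le_sub_right h1 _)) (by positivity))
  field_simp
  ring

theorem FF_nonneg {M α r : ℝ} (hM : 0 < M) (hr : 2 * M < r) (hx : α ^ 2 ≤ xx M α r ^ 2) :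
    0 ≤ FF M α r := by
  have : 0 < r - 2 * M := sub_pos.2 hr
  have : 0 < r := by linarith
  have := sub_nonneg.2 hx
  rw [FF, one_sub_mu_inv hM hr]
  positivity

theorem mul_sq_mul_le_two_mul_cube {α x : ℝ} :
    6 / 5 * (α ^ 2 * (x + 11 / 10 * α) ^ 2 * (α ^ 2 - x ^ 2)) ≤ 2 * (x ^ 2 + α ^ 2) ^ 3 := by
  nlinarith [sq_nonneg (α * (α ^ 2 - 3 * α * x)), sq_nonneg (α * (α ^ 2 - 2 * α * x)),
    sq_nonneg (α * (x ^ 2 + α * x)), sq_nonneg (x ^ 3), sq_nonneg (α * x ^ 2),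
    sq_nonneg (α ^ 2 * x), sq_nonneg (α ^ 3)]

/-- Far out, where `F` is negative, it is dominated by the `f^b` terms. -/
theorem FF_mul_le {M α r : ℝ} (hM : 0 < M) (hs : 50 + 900 * M ≤ √α) (hr : 3 * M < r)
    (ht : √α ≤ rstar M r) (hx : xx M α r ^ 2 ≤ α ^ 2) :
    -(FF M α r * r ^ 6) ≤
      (rstar M r * fbCoeff M r - 9 * M ^ 3 * (r - 3 * M)) / ((α + √α) ^ 2 + α ^ 2) := by
  have hα : 0 < α := Real.sqrt_pos.1 (by linarith)
  have hsq := Real.sq_sqrt hα.le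
  have hr2 : 2 * M < r := by linarith
  have hr0 : 0 < r := by linarith
  have hp : 0 < r - 2 * M := sub_pos.2 hr2
  have hsα : 50 * √α ≤ α := by nlinarith
  have hw : 300 * M ≤ r - 3 * M := by linarith [rstar_le hM hr2]
  have hwt := le_rstar_of_three_mul_le hM hr.le
  have hrx : r ≤ xx M α r + 11 / 10 * α := by rw [xx]; linarith
  have hD : (α + √α) ^ 2 + α ^ 2 ≤ 21 / 10 * α ^ 2 := by nlinarith
  have hmain : 19 / 10 * r ^ 5 ≤
      (rstar M r * fbCoeff M r - 9 * M ^ 3 * (r - 3 * M)) * (r - 2 * M) := by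
    have hQ : 0 ≤ fbCoeff M r := by
      rw [fbCoeff]; exact mul_nonneg hr0.le (by nlinarith)
    have h1 : ((r - 3 * M) * fbCoeff M r - 9 * M ^ 3 * (r - 3 * M)) * (r - 2 * M) ≤
        (rstar M r * fbCoeff M r - 9 * M ^ 3 * (r - 3 * M)) * (r - 2 * M) := by gcongr
    refine le_trans ?_ h1
    obtain ⟨q, rfl⟩ : ∃ q, r = q + 303 * M := ⟨r - 303 * M, by ring⟩
    have hq : 0 ≤ q := by linarith
    rw [fbCoeff, ← sub_nonneg]
    ring_nf
    positivity
  set x := xx M α r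
  have hS : 0 < x ^ 2 + α ^ 2 := by positivity
  have hneg : -(FF M α r * r ^ 6) =
      r ^ 7 * (α ^ 2 - x ^ 2) / (2 * (r - 2 * M) * (x ^ 2 + α ^ 2) ^ 3) := by
    rw [FF, one_sub_mu_inv hM hr2]
    change -(r / (2 * (r - 2 * M)) * ((x ^ 2 - α ^ 2) / (x ^ 2 + α ^ 2) ^ 3) * r ^ 6) = _
    field_simp
    ring
  have hx0 : 0 ≤ α ^ 2 - x ^ 2 := sub_nonneg.2 hx
  rw [hneg, div_le_div_iff₀ (by positivity) (by positivity)]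
  calc r ^ 7 * (α ^ 2 - x ^ 2) * ((α + √α) ^ 2 + α ^ 2)
      = r ^ 5 * (r ^ 2 * (α ^ 2 - x ^ 2) * ((α + √α) ^ 2 + α ^ 2)) := by ring
    _ ≤ r ^ 5 * ((x + 11 / 10 * α) ^ 2 * (α ^ 2 - x ^ 2) * (21 / 10 * α ^ 2)) := by gcongr
    _ = r ^ 5 * (21 / 10 * (α ^ 2 * (x + 11 / 10 * α) ^ 2 * (α ^ 2 - x ^ 2))) := by ring
    _ ≤ r ^ 5 * (19 / 5 * (x ^ 2 + α ^ 2) ^ 3) := by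
        have := mul_sq_mul_le_two_mul_cube (α := α) (x := x)
        have : 0 < (x ^ 2 + α ^ 2) ^ 3 := by positivity
        exact mul_le_mul_of_nonneg_left (by linarith) (by positivity)
    _ = 19 / 10 * r ^ 5 * (2 * (x ^ 2 + α ^ 2) ^ 3) := by ring
    _ ≤ (rstar M r * fbCoeff M r - 9 * M ^ 3 * (r - 3 * M)) * (r - 2 * M) *
          (2 * (x ^ 2 + α ^ 2) ^ 3) := by gcongr
    _ = _ := by ring

theorem stmt_16 (M : ℝ) (hM : 0 < M) :
    ∃ α₀ > (0:ℝ), ∀ α ≥ α₀, ∀ r, 2 * M < r →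
      0 ≤ 2 * fb M α r * (r - 3 * M) * r ^ 2 + HH M α r + FF M α r * r ^ 6 := by
  refine ⟨(50 + 900 * M) ^ 2, by positivity, fun α hα r hr => ?_⟩
  have hs : 50 + 900 * M ≤ √α := Real.le_sqrt_of_sq_le hα
  have hα0 : 0 < α := Real.sqrt_pos.1 (by linarith)
  have hD : 0 < (α + √α) ^ 2 + α ^ 2 := by positivity
  have hr0 : 0 < r := by linarith
  have hxx : xx M α r = rstar M r - α - √α := rfl
  rw [energy_eq hα0]
  rcases le_or_gt (fbCoeff M r) 0 with hQ | hQ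
  · have hr3 : r < 3 * M := by
      by_contra! h
      have : 0 < fbCoeff M r := by rw [fbCoeff]; exact mul_pos hr0 (by nlinarith)
      linarith
    have ht : rstar M r ≤ 0 := by linarith [rstar_le hM hr]
    have h1 := mul_nonneg_of_nonpos_of_nonpos (fb_nonpos hα0 ht) hQ
    have h2 : 9 * M ^ 3 * (r - 3 * M) / ((α + √α) ^ 2 + α ^ 2) ≤ 0 :=
      div_nonpos_of_nonpos_of_nonneg
        (mul_nonpos_of_nonneg_of_nonpos (by positivity) (by linarith)) hD.le
    have h3 := FF_nonneg (α := α) hM hr (by nlinarith)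
    have : 0 ≤ FF M α r * r ^ 6 := by positivity
    linarith
  have hlin : xx M α r ≤ α + √α →
      (rstar M r * fbCoeff M r - 9 * M ^ 3 * (r - 3 * M)) / ((α + √α) ^ 2 + α ^ 2) ≤
        fb M α r * fbCoeff M r - 9 * M ^ 3 * (r - 3 * M) / ((α + √α) ^ 2 + α ^ 2) := by
    intro hx
    rw [sub_div, ← div_mul_eq_mul_div]
    gcongr
    exact rstar_div_le_fb hα0 hx
  rcases le_or_gt (xx M α r) (-α) with hx | hx
  · have h1 := hlin (by linarith)
    have h2 := div_nonneg (sub_nonneg.2 (le_rstar_mul_fbCoeff hM hr hQ.le)) hD.le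
    have h3 := FF_nonneg (α := α) hM hr (by nlinarith)
    have : 0 ≤ FF M α r * r ^ 6 := by positivity
    linarith
  have ht : √α < rstar M r := by linarith
  have hr3 : 3 * M < r := by linarith [rstar_le hM hr]
  rcases le_or_gt (xx M α r) α with hx' | hx'
  · have h1 := hlin (by linarith)
    have h2 := FF_mul_le hM hs hr3 ht.le (sq_le_sq' hx.le hx')
    linarith
  · have h1 := mul_le_mul_of_nonneg_right (le_fb_of_le_xx hα0 hx'.le) hQ.le
    have h2 : 9 * M ^ 3 * (r - 3 * M) / ((α + √α) ^ 2 + α ^ 2) ≤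
        (2 * α + √α) / ((α + √α) ^ 2 + α ^ 2) * fbCoeff M r := by
      rw [div_mul_eq_mul_div]
      refine div_le_div_of_nonneg_right ?_ hD.le
      have hM1 : M ≤ 2 * α + √α := by linarith
      refine le_trans ?_ (mul_le_mul_of_nonneg_right hM1 hQ.le)
      obtain ⟨w, rfl⟩ : ∃ w, r = w + 3 * M := ⟨r - 3 * M, by ring⟩
      have hw : 0 < w := by linarith
      rw [fbCoeff, ← sub_nonneg]
      ring_nf
      positivity
    have h3 := FF_nonneg (α := α) hM hr (by nlinarith)
    have : 0 ≤ FF M α r * r ^ 6 := by positivity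
    linarith
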